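/- Let M be an ergodic row-stochastic matrix on a finite state space Ω with generalized contraction coefficient κ̃ and mixing time t_mix = t_mix(1/4). Let ε ∈ (0,1) and let κ̂ ∈ (0,1) be any number satisfying |(1 − κ̂)/(1 − κ̃) − 1| < ε. Then t_mix/((1 + ε)(1 + ln 4)) ≤ 1/(1 − κ̂) ≤ 2 t_mix/(1 − ε). In particular, for ε = 1/4, (1/3) t_mix ≤ 1/(1 − κ̂) ≤ 3 t_mix. -/

import Mathlib

variable {Ω : Type*} [Fintype Ω] [DecidableEq Ω] [Nonempty Ω]

/-- A probability distribution on `Ω`. -/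
def IsDist (f : Ω → ℝ) : Prop := (∀ x, 0 ≤ f x) ∧ ∑ x, f x = 1

/-- A row-stochastic (Markov) matrix. -/
def IsStochastic (M : Matrix Ω Ω ℝ) : Prop :=
  (∀ i j, 0 ≤ M i j) ∧ ∀ i, ∑ j, M i j = 1

/-- Ergodicity: some power of `M` is entrywise positive. -/
def IsErgodic (M : Matrix Ω Ω ℝ) : Prop := ∃ p : ℕ, 0 < p ∧ ∀ i j, 0 < (M ^ p) i j

/-- Total variation distance between two distributions on `Ω`. -/
noncomputable def tvDist (μ ν : Ω → ℝ) : ℝ := (1 / 2) * ∑ x, |μ x - ν x|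

/-- Dobrushin contraction coefficient `κ(M) = max_{i,j} ‖M(i,·) − M(j,·)‖_TV`. -/
noncomputable def dobrushin (M : Matrix Ω Ω ℝ) : ℝ :=
  Finset.univ.sup' Finset.univ_nonempty fun p : Ω × Ω => tvDist (M p.1) (M p.2)

/-- Generalized contraction coefficient `κ̃ = 1 − sup_{s ≥ 1} (1 − κ(M^s))/s`. -/
noncomputable def genCC (M : Matrix Ω Ω ℝ) : ℝ :=
  1 - ⨆ s : {n : ℕ // 0 < n}, (1 - dobrushin (M ^ (s : ℕ))) / ((s : ℕ) : ℝ)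

/-- Distance to stationarity `h(t) = sup_{μ ∈ Δ_Ω} ‖μ M^t − π‖_TV`. -/
noncomputable def distToStat (M : Matrix Ω Ω ℝ) (π : Ω → ℝ) (t : ℕ) : ℝ :=
  ⨆ μ : {f : Ω → ℝ // IsDist f}, tvDist (Matrix.vecMul μ.1 (M ^ t)) π

/-- Mixing time `t_mix(ξ) = min{t ∈ ℕ : h(t) < ξ}` (with `ℕ = {1,2,…}`). -/
noncomputable def mixTime (M : Matrix Ω Ω ℝ) (π : Ω → ℝ) (ξ : ℝ) : ℕ :=
  sInf {t : ℕ | 0 < t ∧ distToStat M π t < ξ}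

open Finset Matrix

omit [Nonempty Ω] in
lemma IsStochastic.pow {M : Matrix Ω Ω ℝ} (hM : IsStochastic M) (s : ℕ) :
    IsStochastic (M ^ s) := by
  have key : ∀ A : Matrix Ω Ω ℝ, IsStochastic A ↔ A ∈ rowStochastic ℝ Ω := fun A ↦
    mem_rowStochastic_iff_sum.symm
  rw [key] at hM ⊢
  exact pow_mem hM s

omit [DecidableEq Ω] [Nonempty Ω] in
lemma IsDist.vecMul {M : Matrix Ω Ω ℝ} (hM : IsStochastic M) {μ : Ω → ℝ} (hμ : IsDist μ) :
    IsDist (μ ᵥ* M) := by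
  refine ⟨fun y ↦ sum_nonneg fun x _ ↦ mul_nonneg (hμ.1 x) (hM.1 x y), ?_⟩
  simp only [Matrix.vecMul, dotProduct]
  rw [sum_comm]
  simp [← mul_sum, hM.2, hμ.2]

omit [DecidableEq Ω] [Nonempty Ω] in
lemma tvDist_nonneg (μ ν : Ω → ℝ) : 0 ≤ tvDist μ ν := by
  unfold tvDist
  positivity

omit [DecidableEq Ω] [Nonempty Ω] in
lemma tvDist_comm (μ ν : Ω → ℝ) : tvDist μ ν = tvDist ν μ := by
  simp only [tvDist, abs_sub_comm]

omit [DecidableEq Ω] [Nonempty Ω] in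
lemma tvDist_triangle (μ ν ρ : Ω → ℝ) : tvDist μ ρ ≤ tvDist μ ν + tvDist ν ρ := by
  simp only [tvDist]
  rw [← mul_add, ← sum_add_distrib]
  gcongr
  exact abs_sub_le _ _ _

omit [DecidableEq Ω] [Nonempty Ω] in
lemma tvDist_le_one {μ ν : Ω → ℝ} (hμ : IsDist μ) (hν : IsDist ν) : tvDist μ ν ≤ 1 := by
  have h : ∑ x, |μ x - ν x| ≤ ∑ x, (μ x + ν x) := by
    gcongr with x
    have := hμ.1 x
    have := hν.1 x
    exact abs_le.2 ⟨by linarith, by linarith⟩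
  rw [sum_add_distrib, hμ.2, hν.2] at h
  unfold tvDist
  linarith

omit [DecidableEq Ω] in
lemma tvDist_le_dobrushin (M : Matrix Ω Ω ℝ) (i j : Ω) : tvDist (M i) (M j) ≤ dobrushin M :=
  le_sup' (fun p : Ω × Ω ↦ tvDist (M p.1) (M p.2)) (mem_univ (i, j))

omit [DecidableEq Ω] in
lemma dobrushin_nonneg (M : Matrix Ω Ω ℝ) : 0 ≤ dobrushin M :=
  let i := Classical.arbitrary Ω
  (tvDist_nonneg _ _).trans (tvDist_le_dobrushin M i i)

omit [DecidableEq Ω] in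
lemma dobrushin_le_one {M : Matrix Ω Ω ℝ} (hM : IsStochastic M) : dobrushin M ≤ 1 :=
  sup'_le _ _ fun p _ ↦ tvDist_le_one ⟨hM.1 p.1, hM.2 p.1⟩ ⟨hM.1 p.2, hM.2 p.2⟩

omit [DecidableEq Ω] in
/-- The Dobrushin contraction inequality. -/
lemma tvDist_vecMul_le (M : Matrix Ω Ω ℝ) {μ ν : Ω → ℝ} (hμ : IsDist μ) (hν : IsDist ν) :
    tvDist (μ ᵥ* M) (ν ᵥ* M) ≤ dobrushin M * tvDist μ ν := by
  set f : Ω → ℝ := fun x ↦ μ x - ν x with hf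
  set c := tvDist μ ν with hc
  have hsub : ∑ x, (f x)⁺ - ∑ x, (f x)⁻ = 0 := by
    rw [← sum_sub_distrib]
    simp [posPart_sub_negPart, hf, sum_sub_distrib, hμ.2, hν.2]
  have hadd : ∑ x, (f x)⁺ + ∑ x, (f x)⁻ = 2 * c := by
    rw [← sum_add_distrib]
    simp [posPart_add_negPart, hc, tvDist, hf]
  have hpos : ∑ x, (f x)⁺ = c := by linarith
  have hneg : ∑ x, (f x)⁻ = c := by linarith
  rcases (tvDist_nonneg μ ν).eq_or_lt with h0 | h0
  · have hμν : μ = ν := by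
      have h1 : ∑ x, |μ x - ν x| = 0 := by
        unfold tvDist at h0
        linarith
      funext x
      exact sub_eq_zero.1 (abs_eq_zero.1
        ((sum_eq_zero_iff_of_nonneg fun x _ ↦ abs_nonneg _).1 h1 x (mem_univ x)))
    subst hμν
    simp [hc, tvDist]
  have hid (y : Ω) : c * ((μ ᵥ* M) y - (ν ᵥ* M) y) =
      ∑ i, ∑ j, (f i)⁺ * (f j)⁻ * (M i y - M j y) := by
    have h1 : (μ ᵥ* M) y - (ν ᵥ* M) y = ∑ x, (f x)⁺ * M x y - ∑ x, (f x)⁻ * M x y := by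
      simp only [Matrix.vecMul, dotProduct, ← sum_sub_distrib, ← sub_mul, posPart_sub_negPart, hf]
    have h2 : ∑ i, ∑ j, (f i)⁺ * (f j)⁻ * (M i y - M j y) =
        (∑ i, (f i)⁺ * M i y) * (∑ j, (f j)⁻) - (∑ i, (f i)⁺) * ∑ j, (f j)⁻ * M j y := by
      rw [sum_mul_sum, sum_mul_sum, ← sum_sub_distrib]
      refine sum_congr rfl fun i _ ↦ ?_
      rw [← sum_sub_distrib]
      exact sum_congr rfl fun j _ ↦ by ring
    rw [h1, h2, hpos, hneg]
    ring
  have hbound : c * tvDist (μ ᵥ* M) (ν ᵥ* M) ≤ c * (dobrushin M * c) := by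
    calc c * tvDist (μ ᵥ* M) (ν ᵥ* M)
        = 1 / 2 * ∑ y, |c * ((μ ᵥ* M) y - (ν ᵥ* M) y)| := by
          simp only [tvDist, abs_mul, abs_of_pos (show 0 < c from h0), ← mul_sum]
          ring
      _ ≤ 1 / 2 * ∑ y, ∑ i, ∑ j, (f i)⁺ * (f j)⁻ * |M i y - M j y| := by
          gcongr with y
          rw [hid]
          refine (abs_sum_le_sum_abs _ _).trans (sum_le_sum fun i _ ↦ ?_)
          refine (abs_sum_le_sum_abs _ _).trans (sum_le_sum fun j _ ↦ ?_)
          rw [abs_mul, abs_of_nonneg (mul_nonneg (posPart_nonneg _) (negPart_nonneg _))]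
      _ = ∑ i, ∑ j, (f i)⁺ * (f j)⁻ * tvDist (M i) (M j) := by
          rw [sum_comm, mul_sum]
          refine sum_congr rfl fun i _ ↦ ?_
          rw [sum_comm, mul_sum]
          refine sum_congr rfl fun j _ ↦ ?_
          rw [← mul_sum, tvDist]
          ring
      _ ≤ ∑ i, ∑ j, (f i)⁺ * (f j)⁻ * dobrushin M := by
          gcongr with i _ j _
          exact tvDist_le_dobrushin M i j
      _ = c * (dobrushin M * c) := by
          simp only [← sum_mul, ← mul_sum, hpos, hneg]
          ring
  exact le_of_mul_le_mul_left hbound h0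

omit [Nonempty Ω] in
lemma vecMul_pow_of_stationary {M : Matrix Ω Ω ℝ} {π : Ω → ℝ} (hstat : π ᵥ* M = π) (t : ℕ) :
    π ᵥ* M ^ t = π := by
  induction t with
  | zero => simp
  | succ t ih => rw [pow_succ, ← vecMul_vecMul, ih, hstat]

lemma tvDist_vecMul_pow_le {M : Matrix Ω Ω ℝ} (hM : IsStochastic M) {μ π : Ω → ℝ}
    (hμ : IsDist μ) (hπ : IsDist π) (hstat : π ᵥ* M = π) (k : ℕ) :
    tvDist (μ ᵥ* M ^ k) π ≤ dobrushin M ^ k := by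
  induction k with
  | zero => simpa using tvDist_le_one hμ hπ
  | succ k ih =>
    have h := tvDist_vecMul_le M (hμ.vecMul (hM.pow k)) hπ
    rw [hstat, vecMul_vecMul, ← pow_succ] at h
    rw [pow_succ' (dobrushin M)]
    exact h.trans (mul_le_mul_of_nonneg_left ih (dobrushin_nonneg M))

lemma distToStat_mul_le {M : Matrix Ω Ω ℝ} (hM : IsStochastic M) {π : Ω → ℝ}
    (hπ : IsDist π) (hstat : π ᵥ* M = π) (s k : ℕ) :
    distToStat M π (s * k) ≤ dobrushin (M ^ s) ^ k := by
  have : Nonempty {f : Ω → ℝ // IsDist f} := ⟨⟨π, hπ⟩⟩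
  refine ciSup_le fun μ ↦ ?_
  rw [pow_mul]
  exact tvDist_vecMul_pow_le (hM.pow s) μ.2 hπ (vecMul_pow_of_stationary hstat s) k

lemma dobrushin_pow_le_two_mul_distToStat {M : Matrix Ω Ω ℝ} (hM : IsStochastic M) {π : Ω → ℝ}
    (hπ : IsDist π) (t : ℕ) : dobrushin (M ^ t) ≤ 2 * distToStat M π t := by
  have hbdd : BddAbove (Set.range fun μ : {f : Ω → ℝ // IsDist f} ↦
      tvDist (μ.1 ᵥ* M ^ t) π) := by
    refine ⟨1, ?_⟩
    rintro _ ⟨μ, rfl⟩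
    exact tvDist_le_one (μ.2.vecMul (hM.pow t)) hπ
  have hrow (i : Ω) : tvDist ((M ^ t) i) π ≤ distToStat M π t := by
    have hi : IsDist (Pi.single i 1 : Ω → ℝ) := by
      refine ⟨fun x ↦ ?_, by simp⟩
      by_cases h : x = i <;> simp [h]
    have h := le_ciSup hbdd ⟨Pi.single i 1, hi⟩
    rwa [single_one_vecMul] at h
  refine sup'_le _ _ fun p _ ↦ (tvDist_triangle _ π _).trans ?_
  rw [tvDist_comm π]
  linarith [hrow p.1, hrow p.2]

/-- Strict contraction of `M ^ s` bounds the time needed to come within `1 / 4` of `π`. -/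
lemma exists_distToStat_lt {M : Matrix Ω Ω ℝ} (hM : IsStochastic M) {π : Ω → ℝ}
    (hπ : IsDist π) (hstat : π ᵥ* M = π) {s : ℕ} (hs : 0 < s) (h : dobrushin (M ^ s) < 1) :
    ∃ t : ℕ, (0 < t ∧ distToStat M π t < 1 / 4) ∧
      t * ((1 - dobrushin (M ^ s)) / s) ≤ 1 + Real.log 4 := by
  set κ := dobrushin (M ^ s) with hκ
  have hκ0 : 0 ≤ κ := dobrushin_nonneg _
  have hgap : 0 < 1 - κ := by linarith
  have hlog : 0 < Real.log 4 := Real.log_pos (by norm_num)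
  set k := ⌈Real.log 4 / (1 - κ)⌉₊ with hk
  have hk0 : 0 < k := Nat.ceil_pos.2 (div_pos hlog hgap)
  have hk1 : Real.log 4 ≤ k * (1 - κ) := (div_le_iff₀ hgap).1 (Nat.le_ceil _)
  have hk2 : (k : ℝ) * (1 - κ) ≤ Real.log 4 + (1 - κ) := by
    have h2 := (Nat.ceil_lt_add_one (div_pos hlog hgap).le).le
    calc (k : ℝ) * (1 - κ) ≤ (Real.log 4 / (1 - κ) + 1) * (1 - κ) := by gcongr
      _ = Real.log 4 + (1 - κ) := by field_simp
  refine ⟨s * k, ⟨Nat.mul_pos hs hk0, (distToStat_mul_le hM hπ hstat s k).trans_lt ?_⟩, ?_⟩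
  · have hexp : κ < Real.exp (κ - 1) := by
      linarith [Real.add_one_lt_exp (show κ - 1 ≠ 0 by linarith)]
    calc κ ^ k < Real.exp (κ - 1) ^ k := pow_lt_pow_left₀ hexp hκ0 hk0.ne'
      _ = Real.exp (k * (κ - 1)) := (Real.exp_nat_mul _ _).symm
      _ ≤ Real.exp (-Real.log 4) := Real.exp_le_exp.2 (by linarith)
      _ = 1 / 4 := by rw [Real.exp_neg, Real.exp_log (by norm_num), one_div]
  · have hs' : (s : ℝ) ≠ 0 := by exact_mod_cast hs.ne'
    calc ((s * k : ℕ) : ℝ) * ((1 - κ) / s) = k * (1 - κ) := by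
          push_cast
          field_simp
      _ ≤ 1 + Real.log 4 := by linarith

lemma bddAbove_range_gap {M : Matrix Ω Ω ℝ} :
    BddAbove (Set.range fun s : {n : ℕ // 0 < n} ↦
      (1 - dobrushin (M ^ (s : ℕ))) / ((s : ℕ) : ℝ)) := by
  refine ⟨1, ?_⟩
  rintro _ ⟨⟨s, hs⟩, rfl⟩
  have hs' : (1 : ℝ) ≤ s := by exact_mod_cast hs
  exact (div_le_one (by linarith)).2 (by linarith [dobrushin_nonneg (M ^ s)])

lemma one_sub_genCC_nonneg {M : Matrix Ω Ω ℝ} (hM : IsStochastic M) : 0 ≤ 1 - genCC M := by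
  rw [genCC, sub_sub_cancel]
  exact Real.iSup_nonneg fun s ↦
    div_nonneg (sub_nonneg.2 (dobrushin_le_one (hM.pow _))) (Nat.cast_nonneg _)

lemma mixTime_mem {M : Matrix Ω Ω ℝ} (hM : IsStochastic M) {π : Ω → ℝ} (hπ : IsDist π)
    (hstat : π ᵥ* M = π) (hG : 0 < 1 - genCC M) :
    0 < mixTime M π (1 / 4) ∧ distToStat M π (mixTime M π (1 / 4)) < 1 / 4 := by
  have : Nonempty {n : ℕ // 0 < n} := ⟨⟨1, one_pos⟩⟩
  rw [genCC, sub_sub_cancel] at hG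
  obtain ⟨⟨s, hs⟩, hlt⟩ := exists_lt_of_lt_ciSup hG
  have hs' : (0 : ℝ) < s := by exact_mod_cast hs
  have h : dobrushin (M ^ s) < 1 := sub_pos.1 ((div_pos_iff_of_pos_right hs').1 hlt)
  obtain ⟨t, ht, -⟩ := exists_distToStat_lt hM hπ hstat hs h
  exact Nat.sInf_mem (s := {t : ℕ | 0 < t ∧ distToStat M π t < 1 / 4}) ⟨t, ht⟩

lemma mixTime_mul_one_sub_genCC_le {M : Matrix Ω Ω ℝ} (hM : IsStochastic M) {π : Ω → ℝ}
    (hπ : IsDist π) (hstat : π ᵥ* M = π) :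
    mixTime M π (1 / 4) * (1 - genCC M) ≤ 1 + Real.log 4 := by
  have : Nonempty {n : ℕ // 0 < n} := ⟨⟨1, one_pos⟩⟩
  have hlog : 0 < Real.log 4 := Real.log_pos (by norm_num)
  rw [genCC, sub_sub_cancel, Real.mul_iSup_of_nonneg (Nat.cast_nonneg _)]
  refine ciSup_le fun ⟨s, hs⟩ ↦ ?_
  rcases (dobrushin_le_one (hM.pow s)).eq_or_lt with h | h
  · simp only [h, sub_self, zero_div, mul_zero]
    linarith
  · obtain ⟨t, ht, hle⟩ := exists_distToStat_lt hM hπ hstat hs h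
    have hmix : mixTime M π (1 / 4) ≤ t := Nat.sInf_le ht
    refine le_trans ?_ hle
    have hgap : 0 ≤ 1 - dobrushin (M ^ s) := by linarith
    gcongr

lemma one_le_two_mul_mixTime_mul {M : Matrix Ω Ω ℝ} (hM : IsStochastic M) {π : Ω → ℝ}
    (hπ : IsDist π) (hstat : π ᵥ* M = π) (hG : 0 < 1 - genCC M) :
    1 ≤ 2 * mixTime M π (1 / 4) * (1 - genCC M) := by
  obtain ⟨h0, hlt⟩ := mixTime_mem hM hπ hstat hG
  set t := mixTime M π (1 / 4)
  have ht : (0 : ℝ) < t := by exact_mod_cast h0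
  have hκ := dobrushin_pow_le_two_mul_distToStat hM hπ t
  have hle : (1 - dobrushin (M ^ t)) / t ≤ 1 - genCC M := by
    rw [genCC, sub_sub_cancel]
    exact le_ciSup bddAbove_range_gap (⟨t, h0⟩ : {n : ℕ // 0 < n})
  rw [div_le_iff₀ ht] at hle
  linarith

/-- any `κ̂` estimating `1 − κ̃` to relative error `ε` yields
`t_mix/((1+ε)(1+ln 4)) ≤ 1/(1−κ̂) ≤ 2 t_mix/(1−ε)`;
in particular for `ε = 1/4`, `(1/3) t_mix ≤ 1/(1−κ̂) ≤ 3 t_mix`. -/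
theorem mixTime_from_relative_estimate (M : Matrix Ω Ω ℝ) (hM : IsStochastic M)
    (hErg : IsErgodic M) (π : Ω → ℝ) (hπ : IsDist π)
    (hstat : Matrix.vecMul π M = π) (ε : ℝ) (hε : ε ∈ Set.Ioo (0 : ℝ) 1)
    (κhat : ℝ) (hκhat : κhat ∈ Set.Ioo (0 : ℝ) 1)
    (hrel : |(1 - κhat) / (1 - genCC M) - 1| < ε) :
    (mixTime M π (1 / 4) : ℝ) / ((1 + ε) * (1 + Real.log 4)) ≤ 1 / (1 - κhat) ∧
      1 / (1 - κhat) ≤ 2 * (mixTime M π (1 / 4) : ℝ) / (1 - ε) ∧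
      (ε = 1 / 4 →
        (1 / 3 : ℝ) * (mixTime M π (1 / 4) : ℝ) ≤ 1 / (1 - κhat) ∧
          1 / (1 - κhat) ≤ 3 * (mixTime M π (1 / 4) : ℝ)) := by
  obtain ⟨hε0, hε1⟩ := hε
  have hA : 0 < 1 - κhat := by linarith [hκhat.2]
  have hlog : 0 < Real.log 4 := Real.log_pos (by norm_num)
  have hG : 0 < 1 - genCC M := by
    refine (one_sub_genCC_nonneg hM).lt_of_ne fun h ↦ ?_
    rw [← h, div_zero, zero_sub, abs_neg, abs_one] at hrel
    linarith
  obtain ⟨hlo, hhi⟩ := abs_lt.1 hrel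
  have hlo' : (1 - ε) * (1 - genCC M) ≤ 1 - κhat :=
    (le_div_iff₀ hG).1 (by linarith)
  have hhi' : 1 - κhat ≤ (1 + ε) * (1 - genCC M) :=
    (div_le_iff₀ hG).1 (by linarith)
  have hT : (0 : ℝ) ≤ mixTime M π (1 / 4) := Nat.cast_nonneg _
  have hub := mixTime_mul_one_sub_genCC_le hM hπ hstat
  have hlb := one_le_two_mul_mixTime_mul hM hπ hstat hG
  set T : ℝ := (mixTime M π (1 / 4) : ℝ)
  have hmain1 : T / ((1 + ε) * (1 + Real.log 4)) ≤ 1 / (1 - κhat) := by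
    rw [div_le_div_iff₀ (by positivity) hA, one_mul]
    calc T * (1 - κhat) ≤ T * ((1 + ε) * (1 - genCC M)) := by gcongr
      _ = (1 + ε) * (T * (1 - genCC M)) := by ring
      _ ≤ (1 + ε) * (1 + Real.log 4) := by gcongr
  have hmain2 : 1 / (1 - κhat) ≤ 2 * T / (1 - ε) := by
    have hε' : 0 < 1 - ε := by linarith
    rw [div_le_div_iff₀ hA hε', one_mul]
    calc 1 - ε ≤ (1 - ε) * (2 * T * (1 - genCC M)) := le_mul_of_one_le_right hε'.le hlb
      _ = 2 * T * ((1 - ε) * (1 - genCC M)) := by ring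
      _ ≤ 2 * T * (1 - κhat) := by gcongr
  refine ⟨hmain1, hmain2, ?_⟩
  rintro rfl
  constructor
  · have hlog4 : Real.log 4 ≤ 1.4 := by
      rw [show (4 : ℝ) = 2 ^ 2 by norm_num, Real.log_pow]
      push_cast
      linarith [Real.log_two_lt_d9]
    refine le_trans ?_ hmain1
    rw [one_div_mul_eq_div]
    exact div_le_div_of_nonneg_left hT (by positivity) (by linarith)
  · refine hmain2.trans ?_
    rw [div_le_iff₀ (by norm_num)]
    linarith
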